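/- For every δ̃ > 0 there exist a constant s₀ with 0 < s₀ ≤ 1 and a radial function T̂ ∈ C₀^∞(ℝ²) with T̂ ≡ 1 on the ball B_{s₀}, such that the function T := (2π)^{−2} (T̂)^^(−·) (i.e. the inverse Fourier transform of T̂) belongs to W^{2,1}(ℝ²) and satisfies ‖T − G‖_{W^{1,1}(ℝ²)} ≤ δ̃, where G(x) = (2π)^{−1} e^{−|x|²/2} is the Gaussian on ℝ². -/

import Mathlib

open MeasureTheory Metric Set
open scoped RealInnerProductSpace

noncomputable section

abbrev E2 : Type := EuclideanSpace ℝ (Fin 2)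

/-- The standard Gaussian on the plane, `G x = (2π)⁻¹ exp (-|x|²/2)`. -/
def Gauss : E2 → ℝ := fun x => (2 * Real.pi)⁻¹ * Real.exp (-‖x‖ ^ 2 / 2)

open scoped SchwartzMap FourierTransform Topology ContDiff

lemma gauss_scalar_bound (m : ℕ) (t : ℝ) (ht : 0 ≤ t) :
    (1 + t) ^ m * Real.exp (-t ^ 2 / 2) ≤ m.factorial * Real.exp (3 / 2) := by
  have h1 : (1 + t) ^ m ≤ m.factorial * Real.exp (1 + t) := by
    have := Real.pow_div_factorial_le_exp (1 + t) (by linarith) m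
    rw [div_le_iff₀ (by positivity)] at this
    linarith
  calc (1 + t) ^ m * Real.exp (-t ^ 2 / 2)
      ≤ (m.factorial * Real.exp (1 + t)) * Real.exp (-t ^ 2 / 2) := by gcongr
    _ = m.factorial * Real.exp (1 + t + -t ^ 2 / 2) := by rw [Real.exp_add (1 + t)]; ring
    _ ≤ _ := by
        gcongr
        nlinarith [sq_nonneg (t - 1)]

/-- the Fourier side Gaussian -/
def gR : E2 → ℝ := fun x => Real.exp (-‖x‖ ^ 2 / 2)

lemma contDiff_gR : ContDiff ℝ ∞ gR := by
  unfold gR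
  exact Real.contDiff_exp.comp ((contDiff_norm_sq ℝ).neg.div_const 2)

def gS : 𝓢(E2, ℂ) where
  toFun := fun x => (gR x : ℂ)
  smooth' := Complex.ofRealCLM.contDiff.comp contDiff_gR
  decay' := by
    intro k n
    have hf : (fun x : E2 => -‖x‖ ^ 2 / 2).HasTemperateGrowth := by
      have h := Function.HasTemperateGrowth.mul (Function.HasTemperateGrowth.const (E := E2) (-1/2 : ℝ))
        (Function.hasTemperateGrowth_norm_sq E2)
      have e : (fun x : E2 => -‖x‖ ^ 2 / 2) = (fun _ => (-1/2 : ℝ)) * (fun x : E2 => ‖x‖ ^ 2) := by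
        ext x
        simp only [Pi.mul_apply]
        ring
      rw [e]
      exact h
    obtain ⟨l, C, hC, hb⟩ := hf.norm_iteratedFDeriv_le_uniform n
    refine ⟨n.factorial * (C + 1) ^ n * ((k + l * n).factorial * Real.exp (3 / 2)), fun x => ?_⟩
    have hD : ∀ i, 1 ≤ i → i ≤ n → ‖iteratedFDeriv ℝ i (fun x : E2 => -‖x‖ ^ 2 / 2) x‖
        ≤ ((C + 1) * (1 + ‖x‖) ^ l) ^ i := by
      intro i hi hin
      have h1 : 1 ≤ (C + 1) * (1 + ‖x‖) ^ l :=
        one_le_mul_of_one_le_of_one_le (by linarith)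
          (one_le_pow₀ (by linarith [norm_nonneg x]))
      calc _ ≤ C * (1 + ‖x‖) ^ l := hb i hin x
        _ ≤ (C + 1) * (1 + ‖x‖) ^ l := by gcongr; linarith
        _ ≤ _ := le_self_pow₀ h1 (by omega)
    have hCC : ∀ i, i ≤ n → ‖iteratedFDeriv ℝ i (fun t : ℝ => ((Real.exp t : ℝ) : ℂ))
        (-‖x‖ ^ 2 / 2)‖ ≤ Real.exp (-‖x‖ ^ 2 / 2) := by
      intro i _
      have := Complex.ofRealLI.norm_iteratedFDeriv_comp_left (f := Real.exp)
        (x := -‖x‖ ^ 2 / 2) (Real.contDiff_exp (n := i)).contDiffAt (i := i) le_rfl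
      have h2 : (fun t : ℝ => ((Real.exp t : ℝ) : ℂ)) = Complex.ofRealLI ∘ Real.exp := rfl
      rw [h2, this, norm_iteratedFDeriv_eq_norm_iteratedDeriv, iteratedDeriv_eq_iterate,
        Real.iter_deriv_exp, Real.norm_eq_abs, abs_of_pos (Real.exp_pos _)]
    have key := norm_iteratedFDeriv_comp_le (𝕜 := ℝ) (n := n) (N := ∞)
      (g := fun t : ℝ => ((Real.exp t : ℝ) : ℂ)) (f := fun x : E2 => -‖x‖ ^ 2 / 2)
      (Complex.ofRealCLM.contDiff.comp Real.contDiff_exp) hf.1 (mod_cast le_top) x hCC hD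
    have hs := gauss_scalar_bound (k + l * n) ‖x‖ (norm_nonneg x)
    calc ‖x‖ ^ k * ‖iteratedFDeriv ℝ n (fun x => (gR x : ℂ)) x‖
        ≤ (1 + ‖x‖) ^ k * (n.factorial * Real.exp (-‖x‖ ^ 2 / 2)
            * ((C + 1) * (1 + ‖x‖) ^ l) ^ n) := by
          gcongr
          · linarith
          · exact key
      _ = n.factorial * (C + 1) ^ n * ((1 + ‖x‖) ^ (k + l * n) * Real.exp (-‖x‖ ^ 2 / 2)) := by
          rw [mul_pow, ← pow_mul, pow_add]; ring
      _ ≤ _ := by gcongr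

/-- radial cutoff -/
def chiR : E2 → ℝ := fun x => Real.smoothTransition (2 - ‖x‖ ^ 2)

lemma contDiff_chiR : ContDiff ℝ ∞ chiR :=
  Real.smoothTransition.contDiff.comp (contDiff_const.sub (contDiff_norm_sq ℝ))

lemma chiR_one {x : E2} (h : ‖x‖ ≤ 1) : chiR x = 1 := by
  apply Real.smoothTransition.one_of_one_le
  nlinarith [norm_nonneg x]

lemma chiR_zero {x : E2} (h : 2 < ‖x‖) : chiR x = 0 := by
  apply Real.smoothTransition.zero_of_nonpos
  nlinarith [norm_nonneg x]

lemma hasCompactSupport_chiR : HasCompactSupport chiR := by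
  apply HasCompactSupport.of_support_subset_isCompact (isCompact_closedBall (0 : E2) 2)
  intro x hx
  by_contra h
  simp only [mem_closedBall, dist_zero_right, not_le] at h
  exact hx (chiR_zero h)

def chiS : 𝓢(E2, ℂ) :=
  (hasCompactSupport_chiR.comp_left (g := Complex.ofReal) Complex.ofReal_zero).toSchwartzMap
    (Complex.ofRealCLM.contDiff.comp contDiff_chiR)

lemma chiS_apply (x : E2) : chiS x = (chiR x : ℂ) := rfl
lemma gS_apply (x : E2) : gS x = (gR x : ℂ) := rfl

/-- `φ (f(ε ·) - 1)` -/
def pert (f φ : 𝓢(E2, ℂ)) (ε : ℝ) : 𝓢(E2, ℂ) :=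
  SchwartzMap.smulLeftCLM ℂ (fun x => f (ε • x) - 1) φ

lemma pert_growth (f : 𝓢(E2, ℂ)) (ε : ℝ) :
    (fun x => f (ε • x) - 1).HasTemperateGrowth := by
  have h := f.hasTemperateGrowth.comp
    (ε • ContinuousLinearMap.id ℝ E2).hasTemperateGrowth
  exact h.sub (Function.HasTemperateGrowth.const 1)

lemma pert_apply (f φ : 𝓢(E2, ℂ)) (ε : ℝ) (x : E2) :
    pert f φ ε x = (f (ε • x) - 1) * φ x := by
  simp [pert, SchwartzMap.smulLeftCLM_apply_apply (pert_growth f ε)]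

lemma u_bound (f : 𝓢(E2, ℂ)) (hf : f 0 = 1) (i : ℕ) :
    ∃ C : ℝ, 0 ≤ C ∧ ∀ ε : ℝ, 0 < ε → ε ≤ 1 → ∀ x : E2,
      ‖iteratedFDeriv ℝ i (fun x => f (ε • x) - 1) x‖ ≤ ε * C * (1 + ‖x‖) := by
  rcases Nat.eq_zero_or_pos i with rfl | hi
  · refine ⟨SchwartzMap.seminorm ℝ 0 1 f, apply_nonneg _ _, fun ε h0 h1 x => ?_⟩
    have hd : ∀ y ∈ (univ : Set E2), ‖fderiv ℝ f y‖ ≤ SchwartzMap.seminorm ℝ 0 1 f := by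
      intro y _
      have := f.norm_iteratedFDeriv_le_seminorm ℝ 1 y
      rwa [norm_iteratedFDeriv_one] at this
    have := convex_univ.norm_image_sub_le_of_norm_fderiv_le
      (fun y _ => f.differentiableAt) hd (mem_univ (0 : E2)) (mem_univ (ε • x))
    rw [hf, sub_zero, norm_smul, Real.norm_of_nonneg h0.le] at this
    rw [norm_iteratedFDeriv_zero]
    have hp : 0 ≤ SchwartzMap.seminorm ℝ 0 1 f := apply_nonneg _ _
    refine this.trans ?_
    nlinarith [mul_nonneg h0.le hp]
  · refine ⟨SchwartzMap.seminorm ℝ 0 i f, apply_nonneg _ _, fun ε h0 h1 x => ?_⟩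
    have hp : 0 ≤ SchwartzMap.seminorm ℝ 0 i f := apply_nonneg _ _
    have hc : ContDiff ℝ i (fun x => f (ε • x)) :=
      (f.smooth i).comp (contDiff_const_smul ε)
    have e1 : iteratedFDeriv ℝ i (fun x => f (ε • x) - 1) x =
        iteratedFDeriv ℝ i (fun x => f (ε • x)) x - iteratedFDeriv ℝ i (fun _ => (1 : ℂ)) x :=
      iteratedFDeriv_sub_apply (x := x) (i := i) (hc.contDiffAt)
      (contDiff_const (c := (1 : ℂ))).contDiffAt
    rw [e1, iteratedFDeriv_const_of_ne (by omega), Pi.zero_apply, sub_zero,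
      iteratedFDeriv_comp_const_smul _ (f.smooth i), norm_smul, norm_pow,
      Real.norm_of_nonneg h0.le]
    have h2 : ε ^ i ≤ ε := pow_le_of_le_one h0.le h1 (by omega)
    calc ε ^ i * ‖iteratedFDeriv ℝ i f (ε • x)‖ ≤ ε * SchwartzMap.seminorm ℝ 0 i f := by
          gcongr
          exact f.norm_iteratedFDeriv_le_seminorm ℝ i _
      _ ≤ _ := le_mul_of_one_le_right (by positivity) (by linarith [norm_nonneg x])

lemma pert_tendsto (f φ : 𝓢(E2, ℂ)) (hf : f 0 = 1) :
    Filter.Tendsto (pert f φ) (𝓝[>] 0) (𝓝 0) := by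
  choose C hC hb using u_bound f hf
  rw [(schwartz_withSeminorms ℝ E2 ℂ).tendsto_nhds]
  rintro ⟨k, n⟩ δ hδ
  set M : ℝ := ∑ i ∈ Finset.range (n + 1), (n.choose i : ℝ) * C i *
    (SchwartzMap.seminorm ℝ k (n - i) φ + SchwartzMap.seminorm ℝ (k + 1) (n - i) φ) with hM
  have hM0 : 0 ≤ M := Finset.sum_nonneg fun i _ => by
    have := hC i
    have h1 : 0 ≤ SchwartzMap.seminorm ℝ k (n - i) φ := apply_nonneg _ _
    have h2 : 0 ≤ SchwartzMap.seminorm ℝ (k + 1) (n - i) φ := apply_nonneg _ _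
    positivity
  have hbd : ∀ ε : ℝ, 0 < ε → ε ≤ 1 → SchwartzMap.seminorm ℝ k n (pert f φ ε) ≤ ε * M := by
    intro ε h0 h1
    apply SchwartzMap.seminorm_le_bound _ _ _ _ (by positivity)
    intro x
    have e : ⇑(pert f φ ε) = fun x => (f (ε • x) - 1) • φ x := by
      ext x; simp [pert_apply]
    rw [e]
    have hs := norm_iteratedFDeriv_smul_le (𝕜 := ℝ) (pert_growth f ε).1 (φ.smooth ⊤) x (n := n)
      (mod_cast le_top)
    calc _ ≤ ‖x‖ ^ k * ∑ i ∈ Finset.range (n + 1),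
          (n.choose i : ℝ) * ‖iteratedFDeriv ℝ i (fun x => f (ε • x) - 1) x‖
            * ‖iteratedFDeriv ℝ (n - i) φ x‖ := by gcongr
      _ ≤ ε * M := by
        rw [hM, Finset.mul_sum, Finset.mul_sum]
        apply Finset.sum_le_sum
        intro i _
        have a1 := φ.le_seminorm ℝ k (n - i) x
        have a2 := φ.le_seminorm ℝ (k + 1) (n - i) x
        have a3 := hb i ε h0 h1 x
        have := hC i
        calc _ ≤ ‖x‖ ^ k * ((n.choose i : ℝ) * (ε * C i * (1 + ‖x‖))
                * ‖iteratedFDeriv ℝ (n - i) φ x‖) := by gcongr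
          _ = ε * ((n.choose i : ℝ) * C i * (‖x‖ ^ k * ‖iteratedFDeriv ℝ (n - i) φ x‖ +
                ‖x‖ ^ (k + 1) * ‖iteratedFDeriv ℝ (n - i) φ x‖)) := by ring
          _ ≤ _ := by gcongr
  have hev : ∀ᶠ ε : ℝ in 𝓝[>] 0, ε < min 1 (δ / (M + 1)) :=
    (eventually_lt_nhds (by positivity)).filter_mono nhdsWithin_le_nhds
  filter_upwards [hev, self_mem_nhdsWithin] with ε h1 h0
  have h0' : 0 < ε := h0
  have h2 := hbd ε h0' (h1.le.trans (min_le_left _ _))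
  have h3 : ε * (M + 1) < δ := by
    rw [← lt_div_iff₀ (by positivity)]
    exact h1.trans_le (min_le_right _ _)
  simp only [sub_zero]
  change SchwartzMap.seminorm ℝ k n (pert f φ ε) < δ
  linarith

/-- inverse Fourier transform with the `(2π)⁻²` normalisation -/
def IFT (f : E2 → ℂ) : E2 → ℂ := fun x =>
  (((2 * Real.pi) ^ 2)⁻¹ : ℂ) * ∫ ξ : E2, f ξ * Complex.exp (Complex.I * (⟪x, ξ⟫ : ℝ))

lemma IFT_eq (f : 𝓢(E2, ℂ)) (x : E2) :
    IFT f x = (((2 * Real.pi)⁻¹ : ℝ) : ℂ) ^ 2 * (𝓕⁻ f) ((2 * Real.pi)⁻¹ • x) := by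
  rw [SchwartzMap.fourierInv_coe, Real.fourierInv_eq', IFT]
  congr 1
  · push_cast
    rw [inv_pow]
  · congr 1
    ext ξ
    rw [smul_eq_mul, mul_comm]
    congr 2
    rw [inner_smul_right, real_inner_comm, ← mul_assoc, mul_inv_cancel₀ (by positivity), one_mul,
      mul_comm]

lemma IFT_scale (f ψ : 𝓢(E2, ℂ)) (s : ℝ) (hs : 0 < s) (h : ∀ ξ, f ξ = ψ (s⁻¹ • ξ)) (x : E2) :
    IFT f x = ((s : ℝ) : ℂ) ^ 2 * IFT ψ (s • x) := by
  have := Measure.integral_comp_inv_smul_of_nonneg (volume : Measure E2)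
    (fun η => ψ η * Complex.exp (Complex.I * (⟪s • x, η⟫ : ℝ))) (R := s) hs.le
  have e : (fun ξ : E2 => f ξ * Complex.exp (Complex.I * (⟪x, ξ⟫ : ℝ))) =
      fun ξ => ψ (s⁻¹ • ξ) * Complex.exp (Complex.I * (⟪s • x, s⁻¹ • ξ⟫ : ℝ)) := by
    ext ξ
    rw [h, inner_smul_left, inner_smul_right]
    simp [hs.ne']
  unfold IFT
  rw [e, this]
  simp
  ring

lemma IFT_gS (x : E2) : IFT gS x = (Gauss x : ℂ) := by
  have := GaussianFourier.integral_cexp_neg_mul_sq_norm_add (V := E2) (b := 1/2) (by norm_num)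
    Complex.I x
  have e : (fun ξ : E2 => gS ξ * Complex.exp (Complex.I * (⟪x, ξ⟫ : ℝ))) =
      fun v => Complex.exp (-(1/2) * ‖v‖ ^ 2 + Complex.I * (⟪x, v⟫ : ℝ)) := by
    ext ξ
    rw [gS_apply, gR, Complex.ofReal_exp, ← Complex.exp_add]
    congr 2
    push_cast
    ring
  unfold IFT
  rw [e, this, Gauss]
  simp
  have hpi : (Real.pi : ℂ) ≠ 0 := by exact_mod_cast Real.pi_ne_zero
  have : -(‖x‖:ℂ) ^ 2 / (4 * 2⁻¹) = -(‖x‖:ℂ) ^ 2 / 2 := by norm_num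
  rw [this]
  field_simp

/-- The W^{1,1} size of the inverse Fourier transform is continuous on Schwartz space. -/
def Wn (H : 𝓢(E2, ℂ)) : ℝ := (∫ x, ‖H x‖) + ∫ x, ‖fderiv ℝ H x‖

lemma Wn_cont : Continuous fun f : 𝓢(E2, ℂ) => Wn (𝓕⁻ f) := by
  have h : (fun f : 𝓢(E2, ℂ) => Wn (𝓕⁻ f)) = fun f : 𝓢(E2, ℂ) =>
      ‖(𝓕⁻ f).toLp 1 volume‖ + ‖(SchwartzMap.fderivCLM ℝ E2 ℂ (𝓕⁻ f)).toLp 1 volume‖ := by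
    ext f
    rw [SchwartzMap.norm_toLp_one, SchwartzMap.norm_toLp_one]
    rfl
  rw [h]
  have hF : Continuous fun f : 𝓢(E2, ℂ) => 𝓕⁻ f := ContinuousFourierInv.continuous_fourierInv
  exact (SchwartzMap.continuous_toLp.comp hF).norm.add
    (SchwartzMap.continuous_toLp.comp ((SchwartzMap.fderivCLM ℝ E2 ℂ).continuous.comp hF)).norm

lemma Wn_zero : Wn (𝓕⁻ (0 : 𝓢(E2, ℂ))) = 0 := by
  have : 𝓕⁻ (0 : 𝓢(E2, ℂ)) = 0 := FourierTransform.fourierInv_zero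
  rw [this, Wn]
  have : ⇑(0 : 𝓢(E2, ℂ)) = fun _ => 0 := rfl
  simp [this]

lemma exists_pert (f φ : 𝓢(E2, ℂ)) (hf : f 0 = 1) (δ : ℝ) (hδ : 0 < δ) :
    ∃ ε : ℝ, 0 < ε ∧ ε ≤ 1 ∧ Wn (𝓕⁻ (pert f φ ε)) < δ := by
  have h := (Wn_cont.tendsto 0).comp (pert_tendsto f φ hf)
  rw [Wn_zero] at h
  have h1 : ∀ᶠ ε : ℝ in 𝓝[>] 0, ε < 1 :=
    (eventually_lt_nhds (by positivity)).filter_mono nhdsWithin_le_nhds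
  obtain ⟨ε, a, b, c⟩ := ((h.eventually (eventually_lt_nhds hδ)).and
    (h1.and self_mem_nhdsWithin)).exists
  exact ⟨ε, c, b.le, a⟩

lemma dil_int (H : 𝓢(E2, ℂ)) (l : ℝ) (hl : 0 < l) :
    (∫ x, ‖(l : ℂ) ^ 2 * H (l • x)‖) = ∫ x, ‖H x‖ := by
  have := Measure.integral_comp_smul_of_nonneg (volume : Measure E2)
    (fun η => ‖H η‖) l (hR := hl.le)
  simp_rw [norm_mul, integral_const_mul, this]
  simp [hl.ne']

lemma dil_fderiv (H : 𝓢(E2, ℂ)) (l : ℝ) (x : E2) :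
    fderiv ℝ (fun x => (l : ℂ) ^ 2 * H (l • x)) x = (l : ℂ) ^ 2 • (l • fderiv ℝ H (l • x)) := by
  have hd : DifferentiableAt ℝ (fun x => H (l • x)) x :=
    (H.differentiable.comp (differentiable_id.const_smul l)).differentiableAt
  rw [fderiv_const_mul hd, fderiv_comp_smul]

lemma dil_int' (H : 𝓢(E2, ℂ)) (l : ℝ) (hl : 0 < l) (hl1 : l ≤ 1) :
    (∫ x, ‖fderiv ℝ (fun x => (l : ℂ) ^ 2 * H (l • x)) x‖) ≤ ∫ x, ‖fderiv ℝ H x‖ := by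
  have := Measure.integral_comp_smul_of_nonneg (volume : Measure E2)
    (fun η => ‖fderiv ℝ H η‖) l (hR := hl.le)
  simp_rw [dil_fderiv, norm_smul, integral_const_mul, this]
  have h0 : 0 ≤ ∫ x, ‖fderiv ℝ H x‖ := integral_nonneg fun _ => norm_nonneg _
  simp [abs_of_pos hl]
  field_simp
  exact mul_le_of_le_one_left h0 hl1

lemma dil_integrable (H : 𝓢(E2, ℂ)) (l : ℝ) (hl : 0 < l) :
    Integrable (fun x => ‖(l : ℂ) ^ 2 * H (l • x)‖) :=
  (((H.integrable (μ := volume)).comp_smul hl.ne').const_mul _).norm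

lemma dil_integrable' (H : 𝓢(E2, ℂ)) (l : ℝ) (hl : 0 < l) :
    Integrable (fun x => ‖fderiv ℝ (fun x => (l : ℂ) ^ 2 * H (l • x)) x‖) := by
  simp_rw [dil_fderiv]
  have h : Integrable (fun x => fderiv ℝ H x) (volume : Measure E2) :=
    (SchwartzMap.fderivCLM ℝ E2 ℂ H).integrable
  exact (((h.comp_smul hl.ne').smul l).smul ((l : ℂ) ^ 2)).norm

lemma T_integrable (H : 𝓢(E2, ℂ)) (l : ℝ) (hl : 0 < l) (n : ℕ) :
    Integrable (fun x => ‖iteratedFDeriv ℝ n (fun x => (l : ℂ) ^ 2 * H (l • x)) x‖) := by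
  have hc : ContDiff ℝ n (fun x => H (l • x)) := (H.smooth n).comp (contDiff_const_smul l)
  have e : ∀ x, iteratedFDeriv ℝ n (fun x => (l : ℂ) ^ 2 * H (l • x)) x =
      (l : ℂ) ^ 2 • (l ^ n • iteratedFDeriv ℝ n H (l • x)) := by
    intro x
    rw [← congrFun (iteratedFDeriv_comp_const_smul l (H.smooth n)) x]
    exact iteratedFDeriv_const_smul_apply (a := (l : ℂ) ^ 2) hc.contDiffAt
  simp_rw [e, norm_smul]
  have h := H.integrable_pow_mul_iteratedFDeriv volume 0 n
  simp only [pow_zero, one_mul] at h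
  exact ((h.comp_smul hl.ne').const_mul _).const_mul _

theorem stmt1 (δt : ℝ) (hδt : 0 < δt) :
    ∃ (s₀ : ℝ) (That : E2 → ℝ), 0 < s₀ ∧ s₀ ≤ 1 ∧
      ContDiff ℝ (⊤ : ℕ∞) That ∧ HasCompactSupport That ∧
      (∀ x y : E2, ‖x‖ = ‖y‖ → That x = That y) ∧
      (∀ x ∈ ball (0 : E2) s₀, That x = 1) ∧
      ∃ T : E2 → ℂ,
        (∀ x : E2, T x =
          (((2 * Real.pi) ^ 2)⁻¹ : ℂ) *
            ∫ ξ : E2, (That ξ : ℂ) * Complex.exp (Complex.I * (⟪x, ξ⟫ : ℝ))) ∧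
        (∀ n : ℕ, n ≤ 2 → Integrable (fun x => ‖iteratedFDeriv ℝ n T x‖)) ∧
        (∫ x, ‖T x - (Gauss x : ℂ)‖) +
            (∫ x, ‖fderiv ℝ (fun y => T y - (Gauss y : ℂ)) x‖) ≤ δt := by
  have hchi0 : chiS 0 = 1 := by rw [chiS_apply, chiR_one (by simp)]; simp
  have hg0 : gS 0 = 1 := by rw [gS_apply]; simp [gR]
  obtain ⟨ε, hε0, hε1, hεW⟩ := exists_pert chiS gS hchi0 (δt / 2) (by positivity)
  obtain ⟨s, hs0, hs1, hsW⟩ := exists_pert gS chiS hg0 (δt / 2) (by positivity)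
  have hgc := contDiff_gR
  have hcc := contDiff_chiR
  set That : E2 → ℝ := fun ξ => chiR (ε • ξ) * gR ξ + chiR (s⁻¹ • ξ) * (1 - gR ξ) with hThat
  have hsm : ContDiff ℝ ∞ That :=
    ((hcc.comp (contDiff_const_smul ε)).mul hgc).add
      ((hcc.comp (contDiff_const_smul s⁻¹)).mul (contDiff_const.sub hgc))
  have hcs : HasCompactSupport That :=
    ((hasCompactSupport_chiR.comp_smul hε0.ne').mul_right).add
      ((hasCompactSupport_chiR.comp_smul (inv_ne_zero hs0.ne')).mul_right)
  set TS : 𝓢(E2, ℂ) := (hcs.comp_left (g := Complex.ofReal) Complex.ofReal_zero).toSchwartzMap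
    (Complex.ofRealCLM.contDiff.comp hsm) with hTS
  have hTSa : ∀ ξ, TS ξ = (That ξ : ℂ) := fun ξ => rfl
  set F1 := pert chiS gS ε with hF1
  set P2 := pert gS chiS s with hP2
  set F2 : 𝓢(E2, ℂ) := F1 - (TS - gS) with hF2
  have hF2a : ∀ ξ, F2 ξ = P2 (s⁻¹ • ξ) := by
    intro ξ
    simp only [hF2, sub_apply, hF1, hP2, pert_apply, hTSa, hThat, chiS_apply, gS_apply,
      smul_inv_smul₀ hs0.ne']
    push_cast
    ring
  set l : ℝ := (2 * Real.pi)⁻¹ with hl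
  have hl0 : 0 < l := by positivity
  have hl1 : l ≤ 1 := inv_le_one_of_one_le₀ (by linarith [Real.pi_gt_three])
  have hdec : ∀ x, IFT TS x - (Gauss x : ℂ) =
      (l : ℂ) ^ 2 * (𝓕⁻ F1) (l • x) - ((s * l : ℝ) : ℂ) ^ 2 * (𝓕⁻ P2) ((s * l) • x) := by
    intro x
    have e2 : (l : ℂ) ^ 2 * (𝓕⁻ F2) (l • x) =
        ((s * l : ℝ) : ℂ) ^ 2 * (𝓕⁻ P2) ((s * l) • x) := by
      rw [← IFT_eq, IFT_scale F2 P2 s hs0 hF2a, IFT_eq, smul_smul, mul_comm l s, ← hl,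
        Complex.ofReal_mul]
      ring
    rw [← e2, ← IFT_gS, IFT_eq, IFT_eq]
    have e3 : TS + F2 = gS + F1 := by rw [hF2]; abel
    have e4 : 𝓕⁻ TS + 𝓕⁻ F2 = 𝓕⁻ gS + 𝓕⁻ F1 := by
      rw [← FourierTransform.fourierInv_add, ← FourierTransform.fourierInv_add, e3]
    have e5 := DFunLike.congr_fun e4 (l • x)
    simp only [add_apply] at e5
    linear_combination (l : ℂ) ^ 2 * e5
  have hsl0 : 0 < s * l := by positivity
  have hsl1 : s * l ≤ 1 := mul_le_one₀ hs1 hl0.le hl1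
  refine ⟨s, That, hs0, hs1, hsm, hcs, ?_, ?_, IFT TS, fun x => rfl, ?_, ?_⟩
  · intro x y h
    simp only [hThat, chiR, gR, norm_smul, h]
  · intro x hx
    rw [mem_ball_zero_iff] at hx
    have h1 : chiR (ε • x) = 1 := chiR_one (by
      rw [norm_smul, Real.norm_of_nonneg hε0.le]
      exact mul_le_one₀ hε1 (norm_nonneg x) (hx.le.trans hs1))
    have h2 : chiR (s⁻¹ • x) = 1 := chiR_one (by
      rw [norm_smul, Real.norm_of_nonneg (by positivity), inv_mul_le_iff₀ hs0]
      linarith)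
    simp [hThat, h1, h2]
  · intro n _
    have e : IFT TS = fun x => (l : ℂ) ^ 2 * (𝓕⁻ TS) (l • x) := funext (IFT_eq TS)
    rw [e]
    exact T_integrable _ l hl0 n
  · have hA : (∫ x, ‖IFT TS x - (Gauss x : ℂ)‖) ≤
        (∫ x, ‖(𝓕⁻ F1) x‖) + ∫ x, ‖(𝓕⁻ P2) x‖ := by
      rw [← dil_int (𝓕⁻ F1) l hl0, ← dil_int (𝓕⁻ P2) (s * l) hsl0,
        ← integral_add (dil_integrable _ _ hl0) (dil_integrable _ _ hsl0)]
      apply integral_mono_of_nonneg (Filter.Eventually.of_forall fun _ => norm_nonneg _)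
        ((dil_integrable _ _ hl0).add (dil_integrable _ _ hsl0))
      refine Filter.Eventually.of_forall fun x => ?_
      simp only [hdec]
      exact norm_sub_le _ _
    have hd : ∀ (H : 𝓢(E2, ℂ)) (r : ℝ) (x : E2),
        DifferentiableAt ℝ (fun x => (r : ℂ) ^ 2 * H (r • x)) x := fun H r x =>
      ((H.differentiable.comp (differentiable_id.const_smul r)).differentiableAt).const_mul _
    have hB : (∫ x, ‖fderiv ℝ (fun y => IFT TS y - (Gauss y : ℂ)) x‖) ≤
        (∫ x, ‖fderiv ℝ (𝓕⁻ F1 : 𝓢(E2, ℂ)) x‖) + ∫ x, ‖fderiv ℝ (𝓕⁻ P2 : 𝓢(E2, ℂ)) x‖ := by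
      refine le_trans ?_ (add_le_add (dil_int' (𝓕⁻ F1) l hl0 hl1)
        (dil_int' (𝓕⁻ P2) (s * l) hsl0 hsl1))
      rw [← integral_add (dil_integrable' _ _ hl0) (dil_integrable' _ _ hsl0)]
      apply integral_mono_of_nonneg (Filter.Eventually.of_forall fun _ => norm_nonneg _)
        ((dil_integrable' _ _ hl0).add (dil_integrable' _ _ hsl0))
      refine Filter.Eventually.of_forall fun x => ?_
      simp only [hdec]
      rw [fderiv_fun_sub (hd _ _ _) (hd _ _ _)]
      exact norm_sub_le _ _
    unfold Wn at hεW hsW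
    linarith
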